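/- Let N ≥ 2. There exists a constant C = C(N) ≥ 1 such that for every compact set K ⊂ ℝ^{N+1} and every ρ > 0: C^{−1} PH_ρ^N(K) ≤ sup{ μ(K) : μ nonnegative Radon measure on ℝ^{N+1}, supp(μ) ⊂ K, ‖M_2^ρ[μ]‖_{L^∞(ℝ^{N+1})} ≤ 1 } ≤ C PH_ρ^N(K). -/

import Mathlib

open MeasureTheory Metric Set
open scoped ENNReal NNReal

noncomputable section

/-- Points of `ℝ^{N+1}` are written `(x, t)` with `x ∈ ℝ^N` and `t ∈ ℝ`. -/
abbrev PSpace (N : ℕ) := EuclideanSpace ℝ (Fin N) × ℝ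

/-- The parabolic cylinder `Q_δ(x,t) = B_δ(x) × (t - δ², t]`. -/
def pQ (N : ℕ) (δ : ℝ) (z : PSpace N) : Set (PSpace N) :=
  ball z.1 δ ×ˢ Ioc (z.2 - δ ^ 2) z.2

/-- The parabolic cylinder `Q̃_r(x,t) = B_r(x) × (t - r², t + r²)`. -/
def pQt (N : ℕ) (r : ℝ) (z : PSpace N) : Set (PSpace N) :=
  ball z.1 r ×ˢ Ioo (z.2 - r ^ 2) (z.2 + r ^ 2)

/-- The parabolic boundary of an open set `O ⊆ ℝ^{N+1}`: points of the topological
boundary such that every downward cylinder `Q_δ` meets the complement of `O`. -/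
def pBoundary (N : ℕ) (O : Set (PSpace N)) : Set (PSpace N) :=
  {z ∈ frontier O | ∀ δ > 0, (pQ N δ z ∩ Oᶜ).Nonempty}

/-- Partial derivative in time. -/
def tDeriv {N : ℕ} (u : PSpace N → ℝ) (z : PSpace N) : ℝ :=
  deriv (fun s => u (z.1, s)) z.2

/-- Partial derivative in the `i`-th spatial direction. -/
def xDeriv {N : ℕ} (i : Fin N) (u : PSpace N → ℝ) (z : PSpace N) : ℝ :=
  lineDeriv ℝ (fun y => u (y, z.2)) z.1 (EuclideanSpace.single i 1)

/-- Second spatial partial derivative. -/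
def xxDeriv {N : ℕ} (i j : Fin N) (u : PSpace N → ℝ) (z : PSpace N) : ℝ :=
  xDeriv i (xDeriv j u) z

/-- Spatial Laplacian. -/
def lapl {N : ℕ} (u : PSpace N → ℝ) (z : PSpace N) : ℝ :=
  ∑ i : Fin N, xxDeriv i i u z

/-- Euclidean norm of the spatial gradient. -/
def gradNorm {N : ℕ} (u : PSpace N → ℝ) (z : PSpace N) : ℝ :=
  Real.sqrt (∑ i : Fin N, (xDeriv i u z) ^ 2)

/-- `u ∈ C^{2,1}(O)` : `u`, its first and second spatial derivatives and its time
derivative exist and are continuous in `O`. -/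
structure IsC21 {N : ℕ} (O : Set (PSpace N)) (u : PSpace N → ℝ) : Prop where
  cont : ContinuousOn u O
  diff_t : ∀ z ∈ O, DifferentiableAt ℝ (fun s => u (z.1, s)) z.2
  cont_t : ContinuousOn (tDeriv u) O
  diff_x : ∀ (i : Fin N), ∀ z ∈ O,
    LineDifferentiableAt ℝ (fun y => u (y, z.2)) z.1 (EuclideanSpace.single i 1)
  cont_x : ∀ i : Fin N, ContinuousOn (xDeriv i u) O
  diff_xx : ∀ (i j : Fin N), ∀ z ∈ O,
    LineDifferentiableAt ℝ (fun y => xDeriv j u (y, z.2)) z.1 (EuclideanSpace.single i 1)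
  cont_xx : ∀ i j : Fin N, ContinuousOn (xxDeriv i j u) O

/-- The blow-up condition `lim_{δ→0} inf_{O ∩ Q_δ(z)} u = ∞` at every point of the
parabolic boundary. -/
def BlowsUp {N : ℕ} (O : Set (PSpace N)) (u : PSpace N → ℝ) : Prop :=
  ∀ z ∈ pBoundary N O, ∀ M : ℝ, ∃ δ > (0 : ℝ), ∀ w ∈ O ∩ pQ N δ z, M ≤ u w

/-- A large solution of `∂_t u - Δu + f(u) = 0` in `O`. -/
def IsLargeSolution {N : ℕ} (O : Set (PSpace N)) (f : ℝ → ℝ) (u : PSpace N → ℝ) : Prop :=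
  IsC21 O u ∧ (∀ z ∈ O, tDeriv u z - lapl u z + f (u z) = 0) ∧ BlowsUp O u

/-- The parabolic Sobolev norm `‖φ‖_{W^{2,1}_p(ℝ^{N+1})}`. -/
def W21Norm (N : ℕ) (p : ℝ) (φ : PSpace N → ℝ) : ℝ :=
  (eLpNorm φ (ENNReal.ofReal p) volume).toReal
    + (eLpNorm (tDeriv φ) (ENNReal.ofReal p) volume).toReal
    + (eLpNorm (gradNorm φ) (ENNReal.ofReal p) volume).toReal
    + ∑ i : Fin N, ∑ j : Fin N, (eLpNorm (xxDeriv i j φ) (ENNReal.ofReal p) volume).toReal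

/-- The capacity `Cap_{2,1,p}` of a compact set `K ⊆ ℝ^{N+1}`. -/
def cap21c (N : ℕ) (p : ℝ) (K : Set (PSpace N)) : ℝ :=
  sInf { c | ∃ φ : SchwartzMap (PSpace N) ℝ,
    (∃ U, IsOpen U ∧ K ⊆ U ∧ ∀ z ∈ U, 1 ≤ φ z) ∧ c = W21Norm N p (fun z => φ z) ^ p }

/-- The capacity `Cap_{2,1,p}` of an arbitrary (Suslin) set. -/
def cap21 (N : ℕ) (p : ℝ) (E : Set (PSpace N)) : ℝ :=
  sSup { c | ∃ D, D ⊆ E ∧ IsCompact D ∧ c = cap21c N p D }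

/-- The parabolic Hausdorff capacity `PH_ρ^N(E)`. -/
def PHcap (N : ℕ) (ρ : ℝ) (E : Set (PSpace N)) : ℝ≥0∞ :=
  ⨅ (c : ℕ → PSpace N × ℝ)
    (_ : (∀ j, 0 ≤ (c j).2 ∧ (c j).2 ≤ ρ) ∧ E ⊆ ⋃ j, pQt N (c j).2 (c j).1),
    ∑' j, ENNReal.ofReal ((c j).2 ^ N)

/-- The truncated Riesz parabolic potential `I_2^R[μ]`. -/
def riesz (N : ℕ) (R : ℝ) (μ : Measure (PSpace N)) (z : PSpace N) : ℝ≥0∞ :=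
  ∫⁻ ρ in Ioo (0 : ℝ) R, μ (pQt N ρ z) / ENNReal.ofReal (ρ ^ (N + 1))

/-- The truncated fractional maximal parabolic potential `M_2^R[μ]`. -/
def maxPot (N : ℕ) (R : ℝ) (μ : Measure (PSpace N)) (z : PSpace N) : ℝ≥0∞ :=
  ⨆ (ρ : ℝ) (_ : ρ ∈ Ioo (0 : ℝ) R), μ (pQt N ρ z) / ENNReal.ofReal (ρ ^ N)

/-- The Gaussian heat kernel on `ℝ^{N+1}`. -/
def heatK (N : ℕ) (z : PSpace N) : ℝ :=
  if 0 < z.2 then (4 * Real.pi * z.2) ^ (-(N : ℝ) / 2) * Real.exp (-‖z.1‖ ^ 2 / (4 * z.2))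
  else 0

/-- The heat potential `(ℍ * μ)(x,t)` of a nonnegative measure. -/
def heatPot (N : ℕ) (μ : Measure (PSpace N)) (z : PSpace N) : ℝ≥0∞ :=
  ∫⁻ w, ENNReal.ofReal (heatK N (z.1 - w.1, z.2 - w.2)) ∂μ

/-- Exponential on `ℝ≥0∞`. -/
def expE (x : ℝ≥0∞) : ℝ≥0∞ := if x = ⊤ then ⊤ else ENNReal.ofReal (Real.exp x.toReal)

/-- Parabolic distance from a point to a set (taken over points at earlier times). -/
def pDist (N : ℕ) (z : PSpace N) (S : Set (PSpace N)) : ℝ :=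
  sInf { r | ∃ w ∈ S, w.2 ≤ z.2 ∧ r = max (dist z.1 w.1) (Real.sqrt (z.2 - w.2)) }

end

open scoped CompactlySupported

/-- If every finite subfamily covering `X` contains a disjoint subfamily of total weight at least
`P`, then every fractional cover of `X` of multiplicity `t` has weight at least `t * P`. -/
theorem mul_le_sum_of_fractional_cover {X ι : Type*} (Q : ι → Set X) (w : ι → ℝ)
    (hw : ∀ i, 0 ≤ w i) {P : ℝ} (hP0 : 0 ≤ P)
    (hP : ∀ u : Finset ι, (∀ x, ∃ i ∈ u, x ∈ Q i) →
      ∃ v ⊆ u, (v : Set ι).PairwiseDisjoint Q ∧ P ≤ ∑ i ∈ v, w i)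
    (s : Finset ι) : ∀ (c : ι → ℝ) (t : ℝ), (∀ i, 0 ≤ c i) →
      (∀ x, t ≤ ∑ i ∈ s, c i * (Q i).indicator 1 x) → t * P ≤ ∑ i ∈ s, c i * w i := by
  classical
  induction s using Finset.strongInduction with
  | H s ih =>
    intro c t hc hcov
    have hnonneg : ∀ i, 0 ≤ c i * w i := fun i => mul_nonneg (hc i) (hw i)
    rcases le_or_gt t 0 with ht | ht
    · exact (mul_nonpos_of_nonpos_of_nonneg ht hP0).trans (Finset.sum_nonneg fun i _ => hnonneg i)
    obtain ⟨v, hvs, hvd, hvP⟩ := hP s fun x => by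
      by_contra! hx
      have : ∑ i ∈ s, c i * (Q i).indicator 1 x = 0 :=
        Finset.sum_eq_zero fun i hi => by simp [hx i hi]
      linarith [hcov x]
    rcases v.eq_empty_or_nonempty with rfl | hvne
    · have : P = 0 := le_antisymm (by simpa using hvP) hP0
      simpa [this] using Finset.sum_nonneg fun i (_ : i ∈ s) => hnonneg i
    obtain ⟨i₀, hi₀, hmin⟩ := v.exists_min_image c hvne
    rcases le_or_gt t (c i₀) with hle | hlt
    · calc t * P ≤ t * ∑ i ∈ v, w i := by gcongr
        _ = ∑ i ∈ v, t * w i := Finset.mul_sum _ _ _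
        _ ≤ ∑ i ∈ v, c i * w i := Finset.sum_le_sum fun i hi =>
            mul_le_mul_of_nonneg_right (hle.trans (hmin i hi)) (hw i)
        _ ≤ ∑ i ∈ s, c i * w i :=
            Finset.sum_le_sum_of_subset_of_nonneg hvs fun i _ _ => hnonneg i
    set ε := c i₀ with hε
    let c' : ι → ℝ := fun i => c i - if i ∈ v then ε else 0
    have hc' : ∀ i, 0 ≤ c' i := fun i => by
      by_cases hi : i ∈ v
      · simpa [c', hi] using hmin i hi
      · simpa [c', hi] using hc i
    have hc'0 : c' i₀ = 0 := by simp [c', hi₀, hε]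
    have hsum : ∀ g : ι → ℝ,
        ∑ i ∈ s.erase i₀, c' i * g i = ∑ i ∈ s, c i * g i - ε * ∑ i ∈ v, g i := by
      intro g
      rw [Finset.sum_erase _ (by simp [hc'0])]
      simp only [c', sub_mul, Finset.sum_sub_distrib, ite_mul, zero_mul]
      rw [Finset.sum_ite_mem, Finset.inter_eq_right.2 hvs, Finset.mul_sum]
    have key := ih (s.erase i₀) (Finset.erase_ssubset (hvs hi₀)) c' (t - ε) hc' fun x => by
      rw [hsum]
      have hone : ∑ i ∈ v, (Q i).indicator (1 : X → ℝ) x ≤ 1 := by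
        by_cases hx : ∃ j ∈ v, x ∈ Q j
        · obtain ⟨j, hj, hxj⟩ := hx
          rw [Finset.sum_eq_single_of_mem j hj fun i hi hij => indicator_of_notMem
            (fun hxi => Set.disjoint_left.1 (hvd hi hj hij) hxi hxj) _]
          simp [hxj]
        · push Not at hx
          rw [Finset.sum_eq_zero fun i hi => indicator_of_notMem (hx i hi) _]
          exact zero_le_one
      have := mul_le_mul_of_nonneg_left hone (hc i₀)
      linarith [hcov x]
    rw [hsum] at key
    have := mul_le_mul_of_nonneg_left hvP (hc i₀)
    linarith

/-- Frostman-type duality on a compact space: if every fractional cover of `X` by the open sets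
`Q i` has total weight at least `P`, then `X` carries a measure of mass at least `P` giving each
`Q i` mass at most `w i`. -/
theorem exists_measure_le_of_fractional_cover {X ι : Type*} [TopologicalSpace X] [CompactSpace X]
    [T2Space X] [MeasurableSpace X] [BorelSpace X] [Nonempty X]
    (Q : ι → Set X) (hQ : ∀ i, IsOpen (Q i)) (hcov : ⋃ i, Q i = univ)
    (w : ι → ℝ) (hw : ∀ i, 0 ≤ w i) (P : ℝ)
    (hP : ∀ (s : Finset ι) (c : ι → ℝ), (∀ i, 0 ≤ c i) →
      (∀ x, 1 ≤ ∑ i ∈ s, c i * (Q i).indicator 1 x) → P ≤ ∑ i ∈ s, c i * w i) :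
    ∃ μ : Measure X, IsFiniteMeasure μ ∧ (∀ i, μ (Q i) ≤ ENNReal.ofReal (w i)) ∧
      ENNReal.ofReal P ≤ μ univ := by
  classical
  let W : (ι →₀ ℝ) →ₗ[ℝ] ℝ := Finsupp.linearCombination ℝ w
  let L : (ι →₀ ℝ) →ₗ[ℝ] (X → ℝ) :=
    Finsupp.linearCombination ℝ fun i => (Q i).indicator (1 : X → ℝ)
  have hL : ∀ c x, L c x = ∑ i ∈ c.support, c i * (Q i).indicator 1 x := fun c x => by
    simp [L, Finsupp.linearCombination_apply, Finsupp.sum, Finset.sum_apply]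
  have hW : ∀ c, W c = ∑ i ∈ c.support, c i * w i := fun c => by
    simp [W, Finsupp.linearCombination_apply, Finsupp.sum]
  have hW0 : ∀ c : ι →₀ ℝ, 0 ≤ c → 0 ≤ W c := fun c hc => by
    rw [hW]; exact Finset.sum_nonneg fun i _ => mul_nonneg (hc i) (hw i)
  let S : C_c(X, ℝ) → Set ℝ := fun f => {v | ∃ c : ι →₀ ℝ, 0 ≤ c ∧ (∀ x, f x ≤ L c x) ∧ W c = v}
  let p : C_c(X, ℝ) → ℝ := fun f => sInf (S f)
  have hbdd : ∀ f, BddBelow (S f) := fun f =>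
    ⟨0, by rintro _ ⟨c, hc, -, rfl⟩; exact hW0 c hc⟩
  have hp_le : ∀ (f : C_c(X, ℝ)) (c : ι →₀ ℝ), 0 ≤ c → (∀ x, f x ≤ L c x) → p f ≤ W c :=
    fun f c hc hf => csInf_le (hbdd f) ⟨c, hc, hf, rfl⟩
  have hne : ∀ f, (S f).Nonempty := by
    intro f
    obtain ⟨s, hs⟩ := isCompact_univ.elim_finite_subcover Q hQ hcov.ge
    obtain ⟨B, hB⟩ := isCompact_univ.bddAbove_image (f := f) (map_continuous f).continuousOn
    let c : ι →₀ ℝ := Finsupp.onFinset s (fun i => if i ∈ s then |B| else 0) (by simp; tauto)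
    have hc : 0 ≤ c := fun i => by
      by_cases hi : i ∈ s <;> simp [c, hi]
    refine ⟨W c, c, hc, fun x => ?_, rfl⟩
    obtain ⟨i, hi, hxi⟩ := mem_iUnion₂.1 (hs (mem_univ x))
    have hfx : f x ≤ |B| := (hB (mem_image_of_mem f (mem_univ x))).trans (le_abs_self B)
    rcases eq_or_ne |B| 0 with h0 | h0
    · rw [hL]
      exact (hfx.trans h0.le).trans (Finset.sum_nonneg fun j _ =>
        mul_nonneg (hc j) (indicator_nonneg (fun _ _ => zero_le_one) x))
    have hci : c i = |B| := by simp [c, hi]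
    rw [hL]
    refine hfx.trans ?_
    have := Finset.single_le_sum (f := fun i => c i * (Q i).indicator (1 : X → ℝ) x)
      (s := c.support) (fun j _ => mul_nonneg (hc j)
        (indicator_nonneg (fun _ _ => zero_le_one) x)) (Finsupp.mem_support_iff.2 (hci ▸ h0))
    simpa [hxi, hci] using this
  have hp0 : ∀ f, 0 ≤ p f := fun f =>
    le_csInf (hne f) (by rintro _ ⟨c, hc, -, rfl⟩; exact hW0 c hc)
  have hp_add : ∀ f g, p (f + g) ≤ p f + p g := by
    intro f g
    have h1 : ∀ a ∈ S f, ∀ b ∈ S g, p (f + g) ≤ a + b := by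
      rintro _ ⟨c, hc, hcf, rfl⟩ _ ⟨d, hd, hdg, rfl⟩
      rw [← map_add]
      refine hp_le _ _ (add_nonneg hc hd) fun x => ?_
      rw [map_add]
      exact add_le_add (hcf x) (hdg x)
    have h2 : ∀ a ∈ S f, p (f + g) - a ≤ p g := fun a ha =>
      le_csInf (hne g) fun b hb => by linarith [h1 a ha b hb]
    have h3 : p (f + g) - p g ≤ p f := le_csInf (hne f) fun a ha => by linarith [h2 a ha]
    linarith
  have hp_smul_le : ∀ a : ℝ, 0 < a → ∀ f, p (a • f) ≤ a * p f := by
    intro a ha f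
    rw [← div_le_iff₀' ha]
    refine le_csInf (hne f) ?_
    rintro _ ⟨c, hc, hcf, rfl⟩
    rw [div_le_iff₀' ha, ← smul_eq_mul, ← map_smul]
    refine hp_le _ _ (smul_nonneg ha.le hc) fun x => ?_
    rw [map_smul]
    exact mul_le_mul_of_nonneg_left (hcf x) ha.le
  have hp_smul : ∀ a : ℝ, 0 < a → ∀ f, p (a • f) = a * p f := by
    intro a ha f
    refine le_antisymm (hp_smul_le a ha f) ?_
    have := hp_smul_le a⁻¹ (inv_pos.2 ha) (a • f)
    rw [inv_smul_smul₀ ha.ne'] at this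
    rwa [inv_mul_eq_div, le_div_iff₀' ha] at this
  let o : C_c(X, ℝ) := ⟨1, HasCompactSupport.of_compactSpace 1⟩
  have ho1 : ∀ x, o x = 1 := fun _ => rfl
  have ho : o ≠ 0 := fun h => by
    have := DFunLike.congr_fun h (Classical.arbitrary X)
    rw [ho1] at this
    exact one_ne_zero this
  obtain ⟨Λ, hΛo, hΛp⟩ := exists_extension_of_le_sublinear
    (LinearPMap.mkSpanSingleton o (p o) ho) p hp_smul hp_add (by
      rintro ⟨_, hx⟩
      obtain ⟨a, rfl⟩ := Submodule.mem_span_singleton.1 hx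
      rw [LinearPMap.mkSpanSingleton'_apply]
      rcases lt_or_ge 0 a with ha | ha
      · exact (hp_smul a ha o).ge
      · exact (mul_nonpos_of_nonpos_of_nonneg ha (hp0 o)).trans (hp0 _))
  have hΛ1 : Λ o = p o :=
    (hΛo ⟨o, Submodule.mem_span_singleton_self o⟩).trans
      (LinearPMap.mkSpanSingleton_apply ℝ ℝ ho (p o))
  have hΛ0 : ∀ f, 0 ≤ f → 0 ≤ Λ f := by
    intro f hf
    have : p (-f) ≤ W 0 := hp_le _ _ le_rfl fun x => by
      have : 0 ≤ f x := hf x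
      simpa using this
    have h2 := hΛp (-f)
    rw [map_neg] at h2
    rw [map_zero] at this
    linarith
  let Φ : C_c(X, ℝ) →ₚ[ℝ] ℝ := PositiveLinearMap.mk₀ Λ hΛ0
  refine ⟨RealRMK.rieszMeasure Φ, inferInstance, fun i => ?_, ?_⟩
  · rw [(hQ i).measure_eq_iSup_isCompact]
    refine iSup₂_le fun C hCQ => iSup_le fun hC => ?_
    obtain ⟨f, hf1, hf0, hfc, hf01⟩ := exists_continuous_one_zero_of_isCompact hC
      (hQ i).isClosed_compl (disjoint_compl_right_iff_subset.2 hCQ)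
    let g : C_c(X, ℝ) := ⟨f, hfc⟩
    have hg : ∀ x, g x = f x := fun _ => rfl
    refine (RealRMK.rieszMeasure_le_of_eq_one Φ (f := g) (fun x => (hf01 x).1) hC
      fun x hx => hf1 hx).trans (ENNReal.ofReal_le_ofReal ?_)
    have hle : p g ≤ W (Finsupp.single i 1) := by
      refine hp_le _ _ (Finsupp.single_nonneg.2 zero_le_one) fun x => ?_
      by_cases hx : x ∈ Q i
      · simpa [L, hx, hg] using (hf01 x).2
      · simpa [L, hx, hg] using (hf0 hx).le
    have : W (Finsupp.single i 1) = w i := by simp [W]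
    exact (hΛp g).trans (hle.trans_eq this)
  · refine le_trans (ENNReal.ofReal_le_ofReal ?_)
      (RealRMK.le_rieszMeasure_tsupport_subset Φ (f := o) (fun x => by simp [ho1])
        (subset_univ _))
    change P ≤ Λ o
    rw [hΛ1]
    refine le_csInf (hne o) ?_
    rintro _ ⟨c, hc, hco, rfl⟩
    rw [hW]
    refine hP _ _ (fun i => hc i) fun x => ?_
    rw [← hL]
    exact hco x

theorem pQt_nonempty {N : ℕ} {r : ℝ} (hr : 0 < r) (z : PSpace N) : (pQt N r z).Nonempty :=
  ⟨z, mem_ball_self hr, by constructor <;> nlinarith [sq_pos_of_pos hr]⟩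

theorem isOpen_pQt {N : ℕ} (r : ℝ) (z : PSpace N) : IsOpen (pQt N r z) :=
  isOpen_ball.prod isOpen_Ioo

theorem mem_pQt_self {N : ℕ} {r : ℝ} (hr : 0 < r) (z : PSpace N) : z ∈ pQt N r z :=
  ⟨mem_ball_self hr, by constructor <;> nlinarith [sq_pos_of_pos hr]⟩

theorem mem_pQt_iff {N : ℕ} {r : ℝ} {z y : PSpace N} :
    y ∈ pQt N r z ↔ dist y.1 z.1 < r ∧ |y.2 - z.2| < r ^ 2 := by
  simp only [pQt, mem_prod, mem_ball, mem_Ioo, abs_lt]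
  constructor <;> rintro ⟨h1, h2, h3⟩ <;> exact ⟨h1, by linarith, by linarith⟩

theorem pQt_mono {N : ℕ} {r s : ℝ} (hr : 0 ≤ r) (hrs : r ≤ s) (z : PSpace N) :
    pQt N r z ⊆ pQt N s z := fun y hy => by
  rw [mem_pQt_iff] at hy ⊢
  exact ⟨hy.1.trans_le hrs, hy.2.trans_le (by gcongr)⟩

/-- Vitali enlargement: a cylinder meeting another one of at least half its radius lies in the
fivefold enlargement of the latter. -/
theorem pQt_subset_of_inter_nonempty {N : ℕ} {r s : ℝ} {z z' : PSpace N} (hr : 0 ≤ r)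
    (hrs : r ≤ 2 * s) (h : (pQt N r z ∩ pQt N s z').Nonempty) :
    pQt N r z ⊆ pQt N (5 * s) z' := by
  obtain ⟨q, hq1, hq2⟩ := h
  intro y hy
  rw [mem_pQt_iff] at *
  constructor
  · linarith [dist_triangle y.1 z.1 z'.1, dist_triangle z.1 q.1 z'.1, dist_comm z.1 q.1]
  · have : r ^ 2 ≤ (2 * s) ^ 2 := by gcongr
    have h1 := abs_lt.1 hy.2
    have h2 := abs_lt.1 hq1.2
    have h3 := abs_lt.1 hq2.2
    rw [abs_lt]
    constructor <;> nlinarith [sq_nonneg s]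

/-- Finitely many unit cylinders cover a cylinder of radius `5`, uniformly in scale and centre. -/
theorem exists_finset_pQt_cover (N : ℕ) : ∃ F : Finset (PSpace N), ∀ (r : ℝ) (z : PSpace N), 0 < r →
    pQt N (5 * r) z ⊆ ⋃ q ∈ F, pQt N r (z.1 + r • q.1, z.2 + r ^ 2 * q.2) := by
  have hcpt : IsCompact (closedBall (0 : EuclideanSpace ℝ (Fin N)) 5 ×ˢ Icc (-25 : ℝ) 25) :=
    (isCompact_closedBall _ _).prod isCompact_Icc
  obtain ⟨F, -, hF⟩ := hcpt.elim_nhds_subcover (pQt N 1) fun x _ =>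
    (isOpen_pQt 1 x).mem_nhds (mem_pQt_self one_pos x)
  refine ⟨F, fun r z hr y hy => ?_⟩
  rw [mem_pQt_iff] at hy
  have hr2 : 0 < r ^ 2 := by positivity
  let y' : PSpace N := (r⁻¹ • (y.1 - z.1), (y.2 - z.2) / r ^ 2)
  have hy1 : r • y'.1 = y.1 - z.1 := smul_inv_smul₀ hr.ne' _
  have hy2 : r ^ 2 * y'.2 = y.2 - z.2 := mul_div_cancel₀ _ hr2.ne'
  have hy' : y' ∈ closedBall (0 : EuclideanSpace ℝ (Fin N)) 5 ×ˢ Icc (-25 : ℝ) 25 := by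
    have h2 := abs_lt.1 hy.2
    refine ⟨?_, ?_, ?_⟩
    · rw [mem_closedBall_zero_iff]
      have : r * ‖y'.1‖ = ‖y.1 - z.1‖ := by
        rw [← hy1, norm_smul r, Real.norm_of_nonneg hr.le]
      rw [dist_eq_norm, ← this] at hy
      nlinarith [hy.1]
    · exact le_of_mul_le_mul_left (by linarith) hr2
    · exact le_of_mul_le_mul_left (by linarith) hr2
  obtain ⟨q, hq, hyq⟩ := mem_iUnion₂.1 (hF hy')
  refine mem_iUnion₂.2 ⟨q, hq, ?_⟩
  rw [mem_pQt_iff] at hyq ⊢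
  constructor
  · have : y.1 - (z.1 + r • q.1) = r • (y'.1 - q.1) := by rw [smul_sub, hy1]; abel
    rw [dist_eq_norm] at hyq
    rw [dist_eq_norm, this, norm_smul, Real.norm_of_nonneg hr.le]
    nlinarith [hyq.1]
  · have : y.2 - (z.2 + r ^ 2 * q.2) = r ^ 2 * (y'.2 - q.2) := by rw [mul_sub, hy2]; ring
    rw [this, abs_mul, abs_of_pos hr2]
    nlinarith [hyq.2]

/-- A finite cover by cylinders of radius at most `ρ` bounds the capacity. -/
theorem PHcap_le_sum {N : ℕ} (hN : N ≠ 0) {ρ : ℝ} (hρ : 0 ≤ ρ) {E : Set (PSpace N)} {ι : Type*}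
    [Fintype ι] (c : ι → PSpace N × ℝ) (hc : ∀ i, 0 ≤ (c i).2 ∧ (c i).2 ≤ ρ)
    (hE : E ⊆ ⋃ i, pQt N (c i).2 (c i).1) :
    PHcap N ρ E ≤ ∑ i, ENNReal.ofReal ((c i).2 ^ N) := by
  obtain ⟨e, he⟩ := Countable.exists_injective_nat ι
  let d : ℕ → PSpace N × ℝ := Function.extend e c 0
  have hd : ∀ j, 0 ≤ (d j).2 ∧ (d j).2 ≤ ρ := fun j => by
    by_cases hj : ∃ i, e i = j
    · obtain ⟨i, rfl⟩ := hj
      simpa [d, he.extend_apply] using hc i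
    · simpa [d, Function.extend_apply' _ _ _ hj] using hρ
  refine (iInf₂_le d ⟨hd, hE.trans ?_⟩).trans_eq ?_
  · rw [← tsum_fintype (L := .unconditional ι),
      ← tsum_extend_zero he fun i => ENNReal.ofReal ((c i).2 ^ N)]
    refine tsum_congr fun j => ?_
    by_cases hj : ∃ i, e i = j
    · obtain ⟨i, rfl⟩ := hj
      simp [d, he.extend_apply]
    · simp [d, Function.extend_apply' _ _ _ hj, hN]
  · refine iUnion_subset fun i => ?_
    have : d (e i) = c i := he.extend_apply _ _ _
    rw [← this]
    exact subset_iUnion (fun j => pQt N (d j).2 (d j).1) (e i)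

theorem PHcap_ne_top {N : ℕ} (hN : N ≠ 0) {ρ : ℝ} (hρ : 0 < ρ) {K : Set (PSpace N)}
    (hK : IsCompact K) : PHcap N ρ K ≠ ⊤ := by
  obtain ⟨F, -, hF⟩ := hK.elim_nhds_subcover (pQt N ρ) fun x _ =>
    (isOpen_pQt ρ x).mem_nhds (mem_pQt_self hρ x)
  refine ne_top_of_le_ne_top ?_ (PHcap_le_sum hN hρ.le (fun z : F => ((z : PSpace N), ρ))
    (fun _ => ⟨hρ.le, le_rfl⟩) (hF.trans ?_))
  · exact ENNReal.sum_ne_top.2 fun _ _ => ENNReal.ofReal_ne_top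
  · exact iUnion₂_subset fun z hz => subset_iUnion (fun z : F => pQt N ρ (z : PSpace N)) ⟨z, hz⟩

theorem measure_pQt_le_of_maxPot_le {N : ℕ} {ρ : ℝ} {μ : Measure (PSpace N)}
    (hμ : ∀ z, maxPot N ρ μ z ≤ 1) {r : ℝ} (hr0 : 0 < r) (hr : r < ρ) (z : PSpace N) :
    μ (pQt N r z) ≤ ENNReal.ofReal (r ^ N) := by
  have h : μ (pQt N r z) / ENNReal.ofReal (r ^ N) ≤ 1 :=
    (le_iSup₂ (f := fun (s : ℝ) (_ : s ∈ Ioo (0 : ℝ) ρ) =>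
      μ (pQt N s z) / ENNReal.ofReal (s ^ N)) r ⟨hr0, hr⟩).trans (hμ z)
  rwa [ENNReal.div_le_iff (by simpa using pow_pos hr0 N) ENNReal.ofReal_ne_top, one_mul] at h

theorem measure_pQt_le_of_maxPot_le' {N : ℕ} {ρ : ℝ} {μ : Measure (PSpace N)}
    (hμ : ∀ z, maxPot N ρ μ z ≤ 1) {r : ℝ} (hr0 : 0 ≤ r) (hr : r ≤ ρ) (z : PSpace N) :
    μ (pQt N r z) ≤ ENNReal.ofReal (r ^ N) := by
  rcases hr0.eq_or_lt with rfl | hr0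
  · simp [pQt]
  have hlt : ∀ s ∈ Ioo 0 r, μ (pQt N s z) ≤ ENNReal.ofReal (r ^ N) := fun s hs =>
    (measure_pQt_le_of_maxPot_le hμ hs.1 (hs.2.trans_le hr) z).trans
      (ENNReal.ofReal_le_ofReal (pow_le_pow_left₀ hs.1.le hs.2.le N))
  obtain ⟨u, hu, hur, hulim⟩ := exists_seq_strictMono_tendsto' hr0
  have hsub : pQt N r z ⊆ ⋃ n, pQt N (u n) z := by
    intro y hy
    rw [mem_pQt_iff] at hy
    obtain ⟨n, hn1, hn2⟩ := ((hulim.eventually (lt_mem_nhds hy.1)).and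
      ((hulim.pow 2).eventually (lt_mem_nhds hy.2))).exists
    exact mem_iUnion.2 ⟨n, mem_pQt_iff.2 ⟨hn1, hn2⟩⟩
  refine (measure_mono hsub).trans ?_
  have hmono : Monotone fun n => pQt N (u n) z := fun m n hmn =>
    pQt_mono (hur m).1.le (hu.monotone hmn) z
  rw [hmono.measure_iUnion]
  exact iSup_le fun n => hlt _ (hur n)

/-- Measures with `M_2^ρ[μ] ≤ 1` are dominated by the parabolic Hausdorff capacity. -/
theorem measure_le_PHcap {N : ℕ} {ρ : ℝ} {μ : Measure (PSpace N)}
    (hμ : ∀ z, maxPot N ρ μ z ≤ 1) (E : Set (PSpace N)) : μ E ≤ PHcap N ρ E :=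
  le_iInf₂ fun c hc => calc
    μ E ≤ μ (⋃ j, pQt N (c j).2 (c j).1) := measure_mono hc.2
    _ ≤ ∑' j, μ (pQt N (c j).2 (c j).1) := measure_iUnion_le _
    _ ≤ ∑' j, ENNReal.ofReal ((c j).2 ^ N) := ENNReal.tsum_le_tsum fun j =>
      measure_pQt_le_of_maxPot_le' hμ (hc.1 j).1 (hc.1 j).2 _

/-- Every finite cover by cylinders contains a disjoint subfamily whose total weight controls the
capacity, with a constant depending only on `N`. -/
theorem exists_disjoint_PHcap_le {N : ℕ} (hN : N ≠ 0) {F : Finset (PSpace N)}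
    (hF : ∀ (r : ℝ) (z : PSpace N), 0 < r →
      pQt N (5 * r) z ⊆ ⋃ q ∈ F, pQt N r (z.1 + r • q.1, z.2 + r ^ 2 * q.2))
    {ρ : ℝ} (hρ : 0 < ρ) {E : Set (PSpace N)} {ι : Type*} (c : ι → PSpace N × ℝ)
    (hc : ∀ i, 0 < (c i).2 ∧ (c i).2 ≤ ρ) (u : Finset ι)
    (hE : E ⊆ ⋃ i ∈ u, pQt N (c i).2 (c i).1) :
    ∃ v ⊆ u, (v : Set ι).PairwiseDisjoint (fun i => pQt N (c i).2 (c i).1) ∧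
      PHcap N ρ E ≤ ENNReal.ofReal (F.card * ∑ i ∈ v, (c i).2 ^ N) := by
  classical
  obtain ⟨v₀, hv₀u, hdisj, henl⟩ := Vitali.exists_disjoint_subfamily_covering_enlargement
    (fun i => pQt N (c i).2 (c i).1) (u : Set ι) (fun i => (c i).2) 2 one_lt_two
    (fun i _ => (hc i).1.le) ρ (fun i _ => (hc i).2) (fun i _ => pQt_nonempty (hc i).1 _)
  obtain ⟨v, rfl⟩ := (u.finite_toSet.subset hv₀u).exists_finset_coe
  refine ⟨v, Finset.coe_subset.1 hv₀u, hdisj, ?_⟩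
  let d : v × F → PSpace N × ℝ := fun a =>
    (((c a.1).1.1 + (c a.1).2 • (a.2 : PSpace N).1,
      (c a.1).1.2 + (c a.1).2 ^ 2 * (a.2 : PSpace N).2), (c a.1).2)
  refine (PHcap_le_sum hN hρ.le d (fun a => ⟨(hc a.1).1.le, (hc a.1).2⟩) ?_).trans_eq ?_
  · intro y hy
    obtain ⟨i, hi, hyi⟩ := mem_iUnion₂.1 (hE hy)
    obtain ⟨j, hj, hij, hle⟩ := henl i hi
    have hyj := pQt_subset_of_inter_nonempty (hc i).1.le hle hij hyi
    obtain ⟨q, hq, hyq⟩ := mem_iUnion₂.1 (hF _ _ (hc j).1 hyj)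
    exact mem_iUnion.2 ⟨(⟨j, hj⟩, ⟨q, hq⟩), hyq⟩
  · have hpow : ∀ i, 0 ≤ (c i).2 ^ N := fun i => pow_nonneg (hc i).1.le N
    rw [← ENNReal.ofReal_sum_of_nonneg fun a _ => hpow a.1, Fintype.sum_prod_type,
      ← Finset.sum_coe_sort v]
    simp [d, Finset.mul_sum]

/-- Existence half of Frostman's lemma for the parabolic Hausdorff capacity. -/
theorem exists_measure_maxPot_le_one {N : ℕ} (hN : N ≠ 0) {F : Finset (PSpace N)}
    (hF : ∀ (r : ℝ) (z : PSpace N), 0 < r →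
      pQt N (5 * r) z ⊆ ⋃ q ∈ F, pQt N r (z.1 + r • q.1, z.2 + r ^ 2 * q.2))
    {K : Set (PSpace N)} (hK : IsCompact K) (hne : K.Nonempty) {ρ : ℝ} (hρ : 0 < ρ) :
    ∃ μ : Measure (PSpace N),
      (IsFiniteMeasure μ ∧ μ Kᶜ = 0 ∧ ∀ z : PSpace N, maxPot N ρ μ z ≤ 1) ∧
      ENNReal.ofReal ((F.card + 1 : ℝ)⁻¹) * PHcap N ρ K ≤ μ K := by
  have : CompactSpace K := isCompact_iff_compactSpace.1 hK
  have : Nonempty K := hne.to_subtype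
  have hKm : MeasurableSet K := hK.measurableSet
  let ι := {c : PSpace N × ℝ // 0 < c.2 ∧ c.2 ≤ ρ}
  let Q : ι → Set K := fun i => (↑) ⁻¹' pQt N i.1.2 i.1.1
  let w : ι → ℝ := fun i => i.1.2 ^ N
  have hw : ∀ i, 0 ≤ w i := fun i => pow_nonneg i.2.1.le N
  have hfin := PHcap_ne_top hN hρ hK
  have hcard : (0 : ℝ) < F.card + 1 := by positivity
  let P : ℝ := (F.card + 1 : ℝ)⁻¹ * (PHcap N ρ K).toReal
  have hP0 : 0 ≤ P := by positivity
  have hPv : ∀ u : Finset ι, (∀ x, ∃ i ∈ u, x ∈ Q i) →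
      ∃ v ⊆ u, (v : Set ι).PairwiseDisjoint Q ∧ P ≤ ∑ i ∈ v, w i := by
    intro u hu
    obtain ⟨v, hvu, hvd, hv⟩ := exists_disjoint_PHcap_le hN hF hρ (E := K)
      (fun i : ι => i.1) (fun i => i.2) u fun x hx => by
        obtain ⟨i, hi, hxi⟩ := hu ⟨x, hx⟩
        exact mem_iUnion₂.2 ⟨i, hi, hxi⟩
    refine ⟨v, hvu, fun i hi j hj hij => (hvd hi hj hij).preimage _, ?_⟩
    have hs : 0 ≤ ∑ i ∈ v, w i := Finset.sum_nonneg fun i _ => hw i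
    have h1 : (PHcap N ρ K).toReal ≤ F.card * ∑ i ∈ v, w i :=
      ENNReal.toReal_le_of_le_ofReal (by positivity) hv
    rw [inv_mul_le_iff₀ hcard]
    linarith
  obtain ⟨μ, hμfin, hμQ, hμP⟩ := exists_measure_le_of_fractional_cover Q
    (fun i => (isOpen_pQt _ _).preimage continuous_subtype_val)
    (eq_univ_of_forall fun x => mem_iUnion.2 ⟨⟨(x, ρ), hρ, le_rfl⟩, mem_pQt_self hρ _⟩) w hw P
    fun s c hc hcov => by
      simpa using mul_le_sum_of_fractional_cover Q w hw hP0 hPv s c 1 hc hcov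
  refine ⟨μ.map (↑), ⟨inferInstance, ?_, fun z => iSup₂_le fun r hr => ?_⟩, ?_⟩
  · rw [Measure.map_apply measurable_subtype_coe hKm.compl]
    simp
  · rw [Measure.map_apply measurable_subtype_coe (isOpen_pQt r z).measurableSet]
    exact ENNReal.div_le_of_le_mul (by simpa using hμQ ⟨(z, r), hr.1, hr.2.le⟩)
  · rw [Measure.map_apply measurable_subtype_coe hKm, Subtype.coe_preimage_self]
    refine le_trans (le_of_eq ?_) hμP
    rw [ENNReal.ofReal_mul (by positivity), ENNReal.ofReal_toReal hfin]

theorem PHcap_empty {N : ℕ} (hN : N ≠ 0) {ρ : ℝ} (hρ : 0 ≤ ρ) : PHcap N ρ ∅ = 0 := by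
  simpa using PHcap_le_sum hN hρ (ι := Empty) (E := ∅) Empty.elim (fun i => i.elim)
    (empty_subset _)

/-- **Theorem 2.4** (Frostman-type duality). The parabolic Hausdorff capacity
`PH_ρ^N(K)` is comparable to the supremum of `μ(K)` over nonnegative Radon measures
supported in `K` with `‖M_2^ρ[μ]‖_∞ ≤ 1`. -/
theorem PHcap_frostman (N : ℕ) (hN : 2 ≤ N) :
    ∃ C : ℝ, 1 ≤ C ∧ ∀ K : Set (PSpace N), IsCompact K → ∀ ρ > (0 : ℝ),
      ENNReal.ofReal C⁻¹ * PHcap N ρ K ≤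
        (⨆ (μ : Measure (PSpace N))
          (_ : IsFiniteMeasure μ ∧ μ Kᶜ = 0 ∧ ∀ z : PSpace N, maxPot N ρ μ z ≤ 1), μ K) ∧
      (⨆ (μ : Measure (PSpace N))
          (_ : IsFiniteMeasure μ ∧ μ Kᶜ = 0 ∧ ∀ z : PSpace N, maxPot N ρ μ z ≤ 1), μ K) ≤
        ENNReal.ofReal C * PHcap N ρ K := by
  have hN0 : N ≠ 0 := by omega
  obtain ⟨F, hF⟩ := exists_finset_pQt_cover N
  have hC : (1 : ℝ) ≤ F.card + 1 := by simp
  refine ⟨F.card + 1, hC, fun K hK ρ hρ => ⟨?_, ?_⟩⟩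
  · rcases K.eq_empty_or_nonempty with rfl | hne
    · simp [PHcap_empty hN0 hρ.le]
    · obtain ⟨μ, hμ, hμK⟩ := exists_measure_maxPot_le_one hN0 hF hK hne hρ
      exact hμK.trans (le_iSup₂ (f := fun (μ : Measure (PSpace N)) (_ : IsFiniteMeasure μ ∧
        μ Kᶜ = 0 ∧ ∀ z : PSpace N, maxPot N ρ μ z ≤ 1) => μ K) μ hμ)
  · refine iSup₂_le fun μ hμ => (measure_le_PHcap hμ.2.2 K).trans ?_
    exact le_mul_of_one_le_left' (ENNReal.one_le_ofReal.2 hC)
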